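/- Let d ≥ 1 and 0 < r < R. There exists a constant C > 0 such that for every non-negative integer k, every exponent 1 ≤ p ≤ ∞, every λ > 0, and every Schwartz function u : ℝ^d → ℂ whose Fourier transform is supported in the annulus {ξ ∈ ℝ^d : rλ ≤ |ξ| ≤ Rλ}, one has C^{−k−1} · λ^k · ‖u‖_{L^p} ≤ ‖∇^k u‖_{L^p} ≤ C^{k+1} · λ^k · ‖u‖_{L^p}. -/

import Mathlib

open MeasureTheory SchwartzMap Real
open scoped ENNReal FourierTransform

/-- Jensen's inequality for the weight `F`. -/
theorem lintegral_mul_rpow_le {α : Type*} [MeasurableSpace α] {μ : Measure α}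
    {F G : α → ℝ≥0∞} (hF : Measurable F) (hG : Measurable G) {p : ℝ} (hp : 1 ≤ p) :
    (∫⁻ t, F t * G t ∂μ) ^ p ≤ (∫⁻ t, F t ∂μ) ^ (p - 1) * ∫⁻ t, F t * G t ^ p ∂μ := by
  have hp0 : 0 < p := by linarith
  have h := eLpNorm'_le_eLpNorm'_mul_rpow_measure_univ (μ := μ.withDensity F) (f := G) (p := 1)
    (q := p) one_pos hp hG.aestronglyMeasurable
  simp only [eLpNorm', enorm_eq_self, ENNReal.rpow_one, div_one, withDensity_apply _ .univ,
    Measure.restrict_univ] at h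
  rw [lintegral_withDensity_eq_lintegral_mul _ hF hG,
    lintegral_withDensity_eq_lintegral_mul _ hF (hG.pow_const p)] at h
  simp only [Pi.mul_apply] at h
  calc (∫⁻ t, F t * G t ∂μ) ^ p
      ≤ ((∫⁻ t, F t * G t ^ p ∂μ) ^ (1 / p) * (∫⁻ t, F t ∂μ) ^ (1 / 1 - 1 / p)) ^ p := by
        gcongr; simpa using h
    _ = _ := by
        rw [ENNReal.mul_rpow_of_nonneg _ _ hp0.le, ← ENNReal.rpow_mul, ← ENNReal.rpow_mul,
          one_div_mul_cancel hp0.ne', ENNReal.rpow_one, mul_comm]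
        congr 2
        field_simp

theorem lintegral_convolution_rpow_le {G : Type*} [AddCommGroup G] [MeasurableSpace G]
    [MeasurableAdd₂ G] [MeasurableNeg G] {μ : Measure G} [SFinite μ] [μ.IsAddRightInvariant]
    {f g : G → ℝ≥0∞} (hf : Measurable f) (hg : Measurable g) {p : ℝ} (hp : 1 ≤ p) :
    ∫⁻ x, (∫⁻ t, f t * g (x - t) ∂μ) ^ p ∂μ ≤ (∫⁻ t, f t ∂μ) ^ p * ∫⁻ x, g x ^ p ∂μ := by
  calc ∫⁻ x, (∫⁻ t, f t * g (x - t) ∂μ) ^ p ∂μ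
      ≤ ∫⁻ x, (∫⁻ t, f t ∂μ) ^ (p - 1) * ∫⁻ t, f t * g (x - t) ^ p ∂μ ∂μ := by
        refine lintegral_mono fun x ↦ lintegral_mul_rpow_le hf ?_ hp
        exact hg.comp (measurable_const.sub measurable_id)
    _ = (∫⁻ t, f t ∂μ) ^ (p - 1) * ∫⁻ t, f t * ∫⁻ x, g x ^ p ∂μ ∂μ := by
        rw [lintegral_const_mul _ (by fun_prop), lintegral_lintegral_swap (by fun_prop)]
        congr 2 with t
        rw [lintegral_const_mul _ (by fun_prop),
          lintegral_sub_right_eq_self (fun x ↦ g x ^ p) t]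
    _ = _ := by
        rw [lintegral_mul_const _ hf, ← mul_assoc]
        congr 1
        nth_rw 2 [← ENNReal.rpow_one (∫⁻ t, f t ∂μ)]
        rw [← ENNReal.rpow_add_of_nonneg _ _ (by linarith) zero_le_one, sub_add_cancel]

/-- **Young's convolution inequality** with one exponent equal to `1`. -/
theorem eLpNorm_convolution_le {G : Type*} [AddCommGroup G] [MeasurableSpace G]
    [MeasurableAdd₂ G] [MeasurableNeg G] {μ : Measure G} [SFinite μ] [μ.IsAddRightInvariant]
    {f g : G → ℂ} (hf : Measurable f) (hg : Measurable g) {p : ℝ≥0∞} (hp : 1 ≤ p) :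
    eLpNorm (fun x ↦ ∫ t, f t * g (x - t) ∂μ) p μ ≤ eLpNorm f 1 μ * eLpNorm g p μ := by
  have hle (x : G) : ‖∫ t, f t * g (x - t) ∂μ‖ₑ ≤ ∫⁻ t, ‖f t‖ₑ * ‖g (x - t)‖ₑ ∂μ := by
    simpa only [enorm_mul] using enorm_integral_le_lintegral_enorm (fun t ↦ f t * g (x - t))
  rw [eLpNorm_one_eq_lintegral_enorm]
  rcases eq_or_ne p ∞ with rfl | hp'
  · rw [eLpNorm_exponent_top, eLpNorm_exponent_top]
    refine essSup_le_of_ae_le _ (.of_forall fun x ↦ (hle x).trans ?_)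
    rw [← lintegral_mul_const _ (by fun_prop)]
    refine lintegral_mono_ae ?_
    have := (quasiMeasurePreserving_sub_left_of_right_invariant μ x).ae
      (enorm_ae_le_eLpNormEssSup g μ)
    filter_upwards [this] with t ht
    gcongr
  · have hp0 : p ≠ 0 := (one_pos.trans_le hp).ne'
    have hp1 : 1 ≤ p.toReal := by
      simpa using ENNReal.toReal_mono hp' hp
    rw [eLpNorm_eq_lintegral_rpow_enorm_toReal hp0 hp',
      eLpNorm_eq_lintegral_rpow_enorm_toReal hp0 hp']
    calc _ ≤ (∫⁻ x, (∫⁻ t, ‖f t‖ₑ * ‖g (x - t)‖ₑ ∂μ) ^ p.toReal ∂μ) ^ (1 / p.toReal) := by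
          gcongr with x; exact hle x
      _ ≤ ((∫⁻ t, ‖f t‖ₑ ∂μ) ^ p.toReal * ∫⁻ x, ‖g x‖ₑ ^ p.toReal ∂μ) ^ (1 / p.toReal) := by
          gcongr
          exact lintegral_convolution_rpow_le (g := fun x ↦ ‖g x‖ₑ) hf.enorm hg.enorm hp1
      _ = _ := by
          rw [ENNReal.mul_rpow_of_nonneg _ _ (by positivity), ← ENNReal.rpow_mul,
            mul_one_div_cancel (by linarith), ENNReal.rpow_one]

section Multiplier

variable {E : Type*} [NormedAddCommGroup E] [InnerProductSpace ℝ E] [FiniteDimensional ℝ E]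
  [MeasurableSpace E] [BorelSpace E]

theorem fourierInv_comp_inv_smul (m : E → ℂ) {c : ℝ} (hc : 0 < c) (x : E) :
    𝓕⁻ (fun ξ ↦ m (c⁻¹ • ξ)) x = c ^ Module.finrank ℝ E • 𝓕⁻ m (c • x) := by
  rw [Real.fourierInv_eq, Real.fourierInv_eq,
    ← Measure.integral_comp_inv_smul_of_nonneg volume _ hc.le]
  congr with ξ
  rw [real_inner_smul_left, real_inner_smul_right, inv_mul_cancel_left₀ hc.ne']

theorem integral_norm_fourierInv_comp_inv_smul (m : E → ℂ) {c : ℝ} (hc : 0 < c) :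
    ∫ x, ‖𝓕⁻ (fun ξ ↦ m (c⁻¹ • ξ)) x‖ = ∫ x, ‖𝓕⁻ m x‖ := by
  simp_rw [fourierInv_comp_inv_smul m hc, norm_smul, integral_const_mul]
  rw [Measure.integral_comp_smul_of_nonneg volume (fun x ↦ ‖𝓕⁻ m x‖) c (hR := hc.le)]
  simp [abs_of_pos hc, hc.ne']

theorem exists_multiplier_bound {m : E → ℂ} (hm : ContDiff ℝ (⊤ : ℕ∞) m)
    (hms : HasCompactSupport m) :
    ∃ A : ℝ, ∀ c : ℝ, 0 < c → ∃ T : 𝓢(E, ℂ) → 𝓢(E, ℂ),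
      (∀ f ξ, 𝓕 (T f) ξ = m (c⁻¹ • ξ) * 𝓕 f ξ) ∧
      ∀ p : ℝ≥0∞, 1 ≤ p → ∀ f, eLpNorm (T f) p volume ≤
        ENNReal.ofReal A * eLpNorm f p volume := by
  refine ⟨∫ x, ‖𝓕⁻ m x‖, fun c hc ↦ ?_⟩
  have hs : HasCompactSupport fun ξ ↦ m (c⁻¹ • ξ) := hms.comp_smul (inv_ne_zero hc.ne')
  have hd : ContDiff ℝ (⊤ : ℕ∞) fun ξ ↦ m (c⁻¹ • ξ) := hm.comp (contDiff_const_smul _)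
  set M : 𝓢(E, ℂ) := hs.toSchwartzMap hd with hM
  refine ⟨fun f ↦ convolution (ContinuousLinearMap.mul ℂ ℂ) (𝓕⁻ M) f, fun f ξ ↦ ?_,
    fun p hp f ↦ ?_⟩
  · rw [fourier_convolution]
    simp [pairing_apply_apply, hM]
  · have h1 : ⇑(convolution (ContinuousLinearMap.mul ℂ ℂ) (𝓕⁻ M) f) =
        fun x ↦ ∫ t, (𝓕⁻ M) t * f (x - t) := by
      ext x
      rw [convolution_apply, convolution_def]
      simp
    rw [h1]
    refine (eLpNorm_convolution_le (𝓕⁻ M).continuous.measurable f.continuous.measurable hp).trans ?_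
    gcongr
    rw [eLpNorm_one_eq_lintegral_enorm, ← ofReal_integral_norm_eq_lintegral_enorm
      (𝓕⁻ M).integrable, ← integral_norm_fourierInv_comp_inv_smul m hc, fourierInv_coe]
    rfl

end Multiplier

open LineDeriv

section Annulus

variable {E : Type*} [NormedAddCommGroup E] [InnerProductSpace ℝ E] [FiniteDimensional ℝ E]

theorem exists_contDiff_annulus_cutoff {r R : ℝ} (hr : 0 < r) (hrR : r < R) :
    ∃ χ : E → ℝ, ContDiff ℝ (⊤ : ℕ∞) χ ∧ HasCompactSupport χ ∧
      (∀ ξ, r ≤ ‖ξ‖ → ‖ξ‖ ≤ R → χ ξ = 1) ∧ ∀ ξ, ‖ξ‖ ≤ r / 2 → χ ξ = 0 := by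
  let φ : ContDiffBump (0 : E) := ⟨R, R + 1, hr.trans hrR, by linarith⟩
  let ψ : ContDiffBump (0 : E) := ⟨r / 2, r, by linarith, by linarith⟩
  refine ⟨fun ξ ↦ φ ξ * (1 - ψ ξ), φ.contDiff.mul (contDiff_const.sub ψ.contDiff),
    φ.hasCompactSupport.mul_right, fun ξ h1 h2 ↦ ?_, fun ξ h ↦ ?_⟩
  · have hψ : ψ ξ = 0 := ψ.zero_of_le_dist (by simpa using h1)
    have hφ : φ ξ = 1 := φ.one_of_mem_closedBall (by simpa using h2)
    simp [hφ, hψ]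
  · have hψ : ψ ξ = 1 := ψ.one_of_mem_closedBall (by simpa using h)
    simp [hψ]

omit [FiniteDimensional ℝ E] in
theorem contDiff_mul_inner_div_norm_sq {χ : E → ℝ} (hχ : ContDiff ℝ (⊤ : ℕ∞) χ) {ε : ℝ}
    (hε : 0 < ε) (h0 : ∀ ξ, ‖ξ‖ ≤ ε → χ ξ = 0) (v : E) :
    ContDiff ℝ (⊤ : ℕ∞) fun ξ ↦ χ ξ * (inner ℝ ξ v / ‖ξ‖ ^ 2) := by
  refine contDiff_iff_contDiffAt.2 fun ξ ↦ ?_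
  rcases eq_or_ne ξ 0 with rfl | hξ
  · refine (contDiffAt_const (c := (0 : ℝ))).congr_of_eventuallyEq ?_
    filter_upwards [Metric.closedBall_mem_nhds (0 : E) hε] with η hη
    rw [h0 η (by simpa using hη), zero_mul]
  · refine hχ.contDiffAt.mul (.div (contDiff_id.inner ℝ contDiff_const).contDiffAt ?_ (by simpa using hξ))
    exact (contDiff_norm_sq ℝ).contDiffAt

variable [MeasurableSpace E] [BorelSpace E]

theorem SchwartzMap.fourier_lineDerivOp_apply (f : 𝓢(E, ℂ)) (v ξ : E) :
    𝓕 (∂_{v} f) ξ = 2 * π * Complex.I * inner ℝ ξ v * 𝓕 f ξ := by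
  have h : (inner ℝ · v : E → ℝ).HasTemperateGrowth := by fun_prop
  rw [fourier_lineDerivOp_eq]
  simp [h, mul_assoc]

theorem SchwartzMap.support_fourier_lineDerivOp_subset (f : 𝓢(E, ℂ)) (v : E) :
    Function.support ⇑(𝓕 (∂_{v} f) : 𝓢(E, ℂ)) ⊆ Function.support ⇑(𝓕 f : 𝓢(E, ℂ)) := by
  intro ξ hξ h
  exact hξ (by rw [fourier_lineDerivOp_apply, h, mul_zero])

theorem SchwartzMap.support_fourier_iteratedLineDerivOp_subset (f : 𝓢(E, ℂ)) {k : ℕ}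
    (v : Fin k → E) : Function.support ⇑(𝓕 (∂^{v} f) : 𝓢(E, ℂ)) ⊆ Function.support ⇑(𝓕 f : 𝓢(E, ℂ)) := by
  induction k with
  | zero => simp
  | succ k ih =>
    rw [iteratedLineDerivOp_succ_left]
    exact (support_fourier_lineDerivOp_subset _ _).trans (ih _)

theorem SchwartzMap.fourier_injective : Function.Injective (𝓕 : 𝓢(E, ℂ) → 𝓢(E, ℂ)) :=
  fun f g h ↦ by
  simpa using congrArg (FourierTransformInv.fourierInv : 𝓢(E, ℂ) → 𝓢(E, ℂ)) h

theorem exists_eLpNorm_lineDerivOp_le {r R : ℝ} (hr : 0 < r) (hrR : r < R) (v : E) :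
    ∃ A : ℝ, ∀ p : ℝ≥0∞, 1 ≤ p → ∀ c : ℝ, 0 < c → ∀ u : 𝓢(E, ℂ),
      Function.support ⇑(𝓕 u : 𝓢(E, ℂ)) ⊆ {ξ | r * c ≤ ‖ξ‖ ∧ ‖ξ‖ ≤ R * c} →
      eLpNorm ⇑(∂_{v} u : 𝓢(E, ℂ)) p volume ≤ ENNReal.ofReal (A * c) * eLpNorm u p volume := by
  obtain ⟨χ, hχ, hχs, hχ1, -⟩ := exists_contDiff_annulus_cutoff (E := E) hr hrR
  obtain ⟨A, hA⟩ := exists_multiplier_bound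
    (m := fun ξ : E ↦ ((χ ξ * inner ℝ ξ v : ℝ) : ℂ) * (2 * π * Complex.I))
    ((Complex.ofRealCLM.contDiff.comp (hχ.mul (contDiff_id.inner ℝ contDiff_const))).mul contDiff_const)
    ((hχs.mul_right (f' := fun ξ ↦ inner ℝ ξ v)).comp_left Complex.ofReal_zero).mul_right
  refine ⟨A, fun p hp c hc u hu ↦ ?_⟩
  obtain ⟨T, hT, hTb⟩ := hA c hc
  have key : ∂_{v} u = (c : ℂ) • T u := by
    apply fourier_injective
    ext ξ
    rw [fourier_lineDerivOp_apply, FourierTransform.fourier_smul, smul_apply, hT, smul_eq_mul]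
    by_cases h : 𝓕 u ξ = 0
    · simp [h]
    · obtain ⟨h1, h2⟩ := hu h
      have hcn : ‖c⁻¹ • ξ‖ = ‖ξ‖ / c := by
        rw [norm_smul, norm_inv, Real.norm_of_nonneg hc.le]; ring
      rw [hχ1 _ (by rwa [hcn, le_div_iff₀ hc]) (by rwa [hcn, div_le_iff₀ hc]),
        real_inner_smul_left]
      have : (c : ℂ) ≠ 0 := by exact_mod_cast hc.ne'
      push_cast
      field_simp
  rw [key, mul_comm A, ENNReal.ofReal_mul hc.le, mul_assoc]
  change eLpNorm ((c : ℂ) • ⇑(T u)) p volume ≤ _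
  rw [eLpNorm_const_smul, ← ofReal_norm, Complex.norm_real, Real.norm_of_nonneg hc.le]
  gcongr
  exact hTb p hp u

theorem exists_multiplier_inner_div_norm_sq {r R : ℝ} (hr : 0 < r) (hrR : r < R) (v : E) :
    ∃ A : ℝ, ∀ c : ℝ, 0 < c → ∃ T : 𝓢(E, ℂ) → 𝓢(E, ℂ),
      (∀ f ξ, r * c ≤ ‖ξ‖ → ‖ξ‖ ≤ R * c → 𝓕 (T f) ξ =
        c * inner ℝ ξ v / (‖ξ‖ : ℂ) ^ 2 * (2 * π * Complex.I)⁻¹ * 𝓕 f ξ) ∧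
      (∀ (f : 𝓢(E, ℂ)) ξ, 𝓕 f ξ = 0 → 𝓕 (T f) ξ = 0) ∧
      ∀ p : ℝ≥0∞, 1 ≤ p → ∀ f, eLpNorm (T f) p volume ≤
        ENNReal.ofReal A * eLpNorm f p volume := by
  obtain ⟨χ, hχ, hχs, hχ1, hχ0⟩ := exists_contDiff_annulus_cutoff (E := E) hr hrR
  have hd := contDiff_mul_inner_div_norm_sq hχ (half_pos hr) hχ0 v
  have hs : HasCompactSupport fun ξ ↦ χ ξ * (inner ℝ ξ v / ‖ξ‖ ^ 2) := hχs.mul_right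
  have hd' : ContDiff ℝ (⊤ : ℕ∞) fun ξ : E ↦ ((χ ξ * (inner ℝ ξ v / ‖ξ‖ ^ 2) : ℝ) : ℂ) :=
    Complex.ofRealCLM.contDiff.comp hd
  have hs' : HasCompactSupport fun ξ : E ↦ ((χ ξ * (inner ℝ ξ v / ‖ξ‖ ^ 2) : ℝ) : ℂ) :=
    hs.comp_left Complex.ofReal_zero
  obtain ⟨A, hA⟩ := exists_multiplier_bound (hd'.mul (contDiff_const (c := (2 * π * Complex.I)⁻¹)))
    hs'.mul_right
  refine ⟨A, fun c hc ↦ ?_⟩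
  obtain ⟨T, hT, hTb⟩ := hA c hc
  refine ⟨T, fun f ξ h1 h2 ↦ ?_, fun f ξ h ↦ by rw [hT, h, mul_zero], hTb⟩
  have hcn : ‖c⁻¹ • ξ‖ = ‖ξ‖ / c := by
    rw [norm_smul, norm_inv, Real.norm_of_nonneg hc.le]; ring
  have hξ : (‖ξ‖ : ℂ) ≠ 0 := by
    exact_mod_cast (lt_of_lt_of_le (by positivity) h1).ne'
  have hc' : (c : ℂ) ≠ 0 := by exact_mod_cast hc.ne'
  rw [hT, hχ1 _ (by rwa [hcn, le_div_iff₀ hc]) (by rwa [hcn, div_le_iff₀ hc]), hcn,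
    real_inner_smul_left]
  push_cast
  field_simp

theorem exists_eLpNorm_le_sum_lineDerivOp {ι : Type*} [Fintype ι] (b : OrthonormalBasis ι ℝ E)
    {r R : ℝ} (hr : 0 < r) (hrR : r < R) :
    ∃ A : ℝ, 0 ≤ A ∧ ∀ p : ℝ≥0∞, 1 ≤ p → ∀ c : ℝ, 0 < c → ∀ u : 𝓢(E, ℂ),
      Function.support ⇑(𝓕 u : 𝓢(E, ℂ)) ⊆ {ξ | r * c ≤ ‖ξ‖ ∧ ‖ξ‖ ≤ R * c} →
      ENNReal.ofReal c * eLpNorm u p volume ≤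
        ENNReal.ofReal A * ∑ j, eLpNorm ⇑(∂_{b j} u : 𝓢(E, ℂ)) p volume := by
  choose A hA using fun j ↦ exists_multiplier_inner_div_norm_sq hr hrR (b j)
  refine ⟨∑ j, |A j|, by positivity, fun p hp c hc u hu ↦ ?_⟩
  choose T hT hT0 hTb using fun j ↦ hA j c hc
  have key : (c : ℂ) • u = ∑ j, T j (∂_{b j} u) := by
    apply fourier_injective
    ext ξ
    rw [FourierTransform.fourier_smul, FourierTransform.fourier_sum, smul_apply, sum_apply,
      smul_eq_mul]
    by_cases h : 𝓕 u ξ = 0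
    · rw [h, mul_zero]
      refine (Finset.sum_eq_zero fun j _ ↦ hT0 j _ ξ ?_).symm
      rw [fourier_lineDerivOp_apply, h, mul_zero]
    · obtain ⟨h1, h2⟩ := hu h
      have hξ : (‖ξ‖ : ℂ) ≠ 0 := by
        exact_mod_cast (lt_of_lt_of_le (by positivity) h1).ne'
      have hsum : ∑ j, (inner ℝ ξ (b j) : ℂ) ^ 2 = (‖ξ‖ : ℂ) ^ 2 := by
        have := b.sum_sq_inner_left ξ
        exact_mod_cast this
      have hterm (j : ι) : 𝓕 (T j (∂_{b j} u)) ξ =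
          (inner ℝ ξ (b j) : ℂ) ^ 2 * (c * 𝓕 u ξ / (‖ξ‖ : ℂ) ^ 2) := by
        rw [hT j _ ξ h1 h2, fourier_lineDerivOp_apply]
        have hπ : (π : ℂ) ≠ 0 := by exact_mod_cast pi_ne_zero
        field_simp
      simp_rw [hterm]
      rw [← Finset.sum_mul, hsum]
      field_simp
  calc ENNReal.ofReal c * eLpNorm u p volume = eLpNorm ⇑((c : ℂ) • u) p volume := by
        change _ = eLpNorm ((c : ℂ) • ⇑u) p volume
        rw [eLpNorm_const_smul, ← ofReal_norm, Complex.norm_real,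
          Real.norm_of_nonneg hc.le]
    _ = eLpNorm (∑ j, ⇑(T j (∂_{b j} u))) p volume := by
        rw [key]
        congr 1
        ext x
        simp [sum_apply]
    _ ≤ ∑ j, eLpNorm (T j (∂_{b j} u)) p volume :=
        eLpNorm_sum_le (fun j _ ↦ (T j _).continuous.aestronglyMeasurable) hp
    _ ≤ ∑ j, ENNReal.ofReal (∑ j, |A j|) * eLpNorm ⇑(∂_{b j} u : 𝓢(E, ℂ)) p volume := by
        gcongr with j
        refine (hTb j p hp _).trans ?_
        gcongr
        exact (le_abs_self _).trans
          (Finset.single_le_sum (f := fun j ↦ |A j|) (fun i _ ↦ abs_nonneg _) (Finset.mem_univ j))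
    _ = _ := by rw [Finset.mul_sum]

end Annulus

section Iterate

variable {E : Type*} [NormedAddCommGroup E] [InnerProductSpace ℝ E] {ι : Type*} [Fintype ι]

theorem ContinuousMultilinearMap.opNorm_le_sum_orthonormalBasis {k : ℕ} {F : Type*}
    [NormedAddCommGroup F] [NormedSpace ℝ F]
    (b : OrthonormalBasis ι ℝ E) (D : E [×k]→L[ℝ] F) :
    ‖D‖ ≤ ∑ s : Fin k → ι, ‖D fun i ↦ b (s i)‖ := by
  classical
  refine D.opNorm_le_bound (by positivity) fun m ↦ ?_
  have hm : D m = ∑ s : Fin k → ι, (∏ i, inner ℝ (b (s i)) (m i)) • D fun i ↦ b (s i) := by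
    conv_lhs => rw [show m = fun i ↦ ∑ j, inner ℝ (b j) (m i) • b j from
      funext fun i ↦ (b.sum_repr' (m i)).symm]
    rw [D.map_sum]
    simp_rw [D.map_smul_univ]
  rw [hm, Finset.sum_mul]
  refine (norm_sum_le _ _).trans (Finset.sum_le_sum fun s _ ↦ ?_)
  rw [norm_smul, mul_comm, norm_prod]
  gcongr with i
  simpa using norm_inner_le_norm (𝕜 := ℝ) (b (s i)) (m i)

variable [MeasurableSpace E] [BorelSpace E] [FiniteDimensional ℝ E]

theorem eLpNorm_iteratedLineDerivOp_le (b : OrthonormalBasis ι ℝ E) (u : 𝓢(E, ℂ)) {k : ℕ}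
    (s : Fin k → ι) (p : ℝ≥0∞) :
    eLpNorm ⇑(∂^{fun i ↦ b (s i)} u : 𝓢(E, ℂ)) p volume ≤
      eLpNorm (iteratedFDeriv ℝ k u) p volume := by
  refine eLpNorm_mono fun x ↦ ?_
  rw [iteratedLineDerivOp_eq_iteratedFDeriv]
  simpa using (iteratedFDeriv ℝ k u x).le_opNorm fun i ↦ b (s i)

theorem eLpNorm_iteratedFDeriv_le_sum (b : OrthonormalBasis ι ℝ E) (u : 𝓢(E, ℂ)) (k : ℕ)
    {p : ℝ≥0∞} (hp : 1 ≤ p) :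
    eLpNorm (iteratedFDeriv ℝ k u) p volume ≤
      ∑ s : Fin k → ι, eLpNorm ⇑(∂^{fun i ↦ b (s i)} u : 𝓢(E, ℂ)) p volume := by
  calc eLpNorm (iteratedFDeriv ℝ k u) p volume
      ≤ eLpNorm (∑ s : Fin k → ι, fun x ↦ ‖(∂^{fun i ↦ b (s i)} u : 𝓢(E, ℂ)) x‖) p volume := by
        refine eLpNorm_mono_real fun x ↦ ?_
        simp_rw [Finset.sum_apply, iteratedLineDerivOp_eq_iteratedFDeriv]
        exact (iteratedFDeriv ℝ k u x).opNorm_le_sum_orthonormalBasis b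
    _ ≤ ∑ s : Fin k → ι, eLpNorm (fun x ↦ ‖(∂^{fun i ↦ b (s i)} u : 𝓢(E, ℂ)) x‖) p volume :=
        eLpNorm_sum_le (fun s _ ↦ (SchwartzMap.continuous _).norm.aestronglyMeasurable) hp
    _ = _ := by simp_rw [eLpNorm_norm]

theorem eLpNorm_iteratedLineDerivOp_le_of_forall (b : OrthonormalBasis ι ℝ E) {S : Set E}
    {p : ℝ≥0∞} {A : ℝ≥0∞}
    (hA : ∀ j, ∀ u : 𝓢(E, ℂ), Function.support ⇑(𝓕 u : 𝓢(E, ℂ)) ⊆ S →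
      eLpNorm ⇑(∂_{b j} u : 𝓢(E, ℂ)) p volume ≤ A * eLpNorm u p volume)
    (u : 𝓢(E, ℂ)) (hu : Function.support ⇑(𝓕 u : 𝓢(E, ℂ)) ⊆ S) {k : ℕ} (s : Fin k → ι) :
    eLpNorm ⇑(∂^{fun i ↦ b (s i)} u : 𝓢(E, ℂ)) p volume ≤ A ^ k * eLpNorm u p volume := by
  induction k with
  | zero => simp
  | succ k ih =>
    rw [iteratedLineDerivOp_succ_left, pow_succ', mul_assoc]
    refine (hA _ _ ((support_fourier_iteratedLineDerivOp_subset _ _).trans hu)).trans ?_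
    gcongr
    exact ih (Fin.tail s)

theorem pow_mul_eLpNorm_le_of_forall (b : OrthonormalBasis ι ℝ E) {S : Set E}
    {p : ℝ≥0∞} {A c : ℝ≥0∞}
    (hA : ∀ u : 𝓢(E, ℂ), Function.support ⇑(𝓕 u : 𝓢(E, ℂ)) ⊆ S →
      c * eLpNorm u p volume ≤ A * ∑ j, eLpNorm ⇑(∂_{b j} u : 𝓢(E, ℂ)) p volume)
    (u : 𝓢(E, ℂ)) (hu : Function.support ⇑(𝓕 u : 𝓢(E, ℂ)) ⊆ S) {k : ℕ} {B : ℝ≥0∞}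
    (hB : ∀ s : Fin k → ι, eLpNorm ⇑(∂^{fun i ↦ b (s i)} u : 𝓢(E, ℂ)) p volume ≤ B) :
    c ^ k * eLpNorm u p volume ≤ (Fintype.card ι * A) ^ k * B := by
  induction k generalizing u with
  | zero => simpa using hB Fin.elim0
  | succ k ih =>
    calc c ^ (k + 1) * eLpNorm u p volume = c ^ k * (c * eLpNorm u p volume) := by ring
      _ ≤ c ^ k * (A * ∑ j, eLpNorm ⇑(∂_{b j} u : 𝓢(E, ℂ)) p volume) := by
          exact mul_le_mul_right (hA u hu) _
      _ = A * ∑ j, c ^ k * eLpNorm ⇑(∂_{b j} u : 𝓢(E, ℂ)) p volume := by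
          rw [← Finset.mul_sum]; ring
      _ ≤ A * ∑ _j : ι, (Fintype.card ι * A) ^ k * B := by
          refine mul_le_mul_right (Finset.sum_le_sum fun j _ ↦ ?_) _
          refine ih _ ((support_fourier_lineDerivOp_subset u _).trans hu) fun s ↦ ?_
          have h := hB (Fin.snoc s j)
          rw [iteratedLineDerivOp_succ_right] at h
          simpa [Fin.init_def] using h
      _ = _ := by
          rw [Finset.sum_const, Finset.card_univ, nsmul_eq_mul]; ring

end Iterate

/-- **Bernstein's second inequality.** If the Fourier transform of a Schwartz function
`u : ℝ^d → ℂ` is supported in the annulus `{ξ : r λ ≤ |ξ| ≤ R λ}`, then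
`C^{-k-1} λ^k ‖u‖_{L^p} ≤ ‖∇^k u‖_{L^p} ≤ C^{k+1} λ^k ‖u‖_{L^p}` for all `1 ≤ p ≤ ∞`. -/
theorem bernstein_annulus (d : ℕ) (hd : 1 ≤ d) (r R : ℝ) (hr : 0 < r) (hrR : r < R) :
    ∃ C > 0, ∀ (k : ℕ) (p : ℝ≥0∞), 1 ≤ p → ∀ lam : ℝ, 0 < lam →
      ∀ u : SchwartzMap (EuclideanSpace ℝ (Fin d)) ℂ,
        (Function.support (𝓕 ⇑u) ⊆ {ξ | r * lam ≤ ‖ξ‖ ∧ ‖ξ‖ ≤ R * lam}) →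
        ENNReal.ofReal (C⁻¹ ^ (k + 1) * lam ^ k) * eLpNorm (⇑u) p volume ≤
            eLpNorm (iteratedFDeriv ℝ k ⇑u) p volume ∧
          eLpNorm (iteratedFDeriv ℝ k ⇑u) p volume ≤
            ENNReal.ofReal (C ^ (k + 1) * lam ^ k) * eLpNorm (⇑u) p volume := by
  let b := EuclideanSpace.basisFun (Fin d) ℝ
  choose A₁ hA₁ using fun j ↦ exists_eLpNorm_lineDerivOp_le hr hrR (b j)
  obtain ⟨A₂, hA₂0, hA₂⟩ := exists_eLpNorm_le_sum_lineDerivOp b hr hrR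
  set A : ℝ := ∑ j, |A₁ j| with hA
  have hA0 : 0 ≤ A := by positivity
  have hle (j : Fin d) : A₁ j ≤ A := (le_abs_self _).trans
    (Finset.single_le_sum (f := fun j ↦ |A₁ j|) (fun i _ ↦ abs_nonneg _) (Finset.mem_univ j))
  set C : ℝ := 1 + d * A + d * A₂ with hC
  have hdA : 0 ≤ d * A := by positivity
  have hdA₂ : 0 ≤ d * A₂ := by positivity
  have hC1 : 1 ≤ C := by linarith
  have hC0 : 0 < C := by linarith
  refine ⟨C, hC0, fun k p hp lam hlam u hu ↦ ⟨?_, ?_⟩⟩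
  · have h := pow_mul_eLpNorm_le_of_forall b (hA₂ p hp lam hlam) u hu
      fun s : Fin k → Fin d ↦ eLpNorm_iteratedLineDerivOp_le b u s p
    have hdA₂' : (Fintype.card (Fin d) : ℝ≥0∞) * ENNReal.ofReal A₂ = ENNReal.ofReal (d * A₂) := by
      rw [ENNReal.ofReal_mul (by positivity)]; simp
    rw [hdA₂', ← ENNReal.ofReal_pow hlam.le, ← ENNReal.ofReal_pow hdA₂] at h
    have hone : C⁻¹ ^ (k + 1) * (d * A₂) ^ k ≤ 1 := by
      rw [inv_pow, inv_mul_le_one₀ (by positivity)]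
      calc (d * A₂) ^ k ≤ C ^ k := by gcongr; linarith
        _ ≤ C ^ (k + 1) := pow_le_pow_right₀ hC1 (Nat.le_succ k)
    calc ENNReal.ofReal (C⁻¹ ^ (k + 1) * lam ^ k) * eLpNorm (⇑u) p volume
        = ENNReal.ofReal (C⁻¹ ^ (k + 1)) *
            (ENNReal.ofReal (lam ^ k) * eLpNorm (⇑u) p volume) := by
          rw [ENNReal.ofReal_mul (by positivity), mul_assoc]
      _ ≤ ENNReal.ofReal (C⁻¹ ^ (k + 1)) *
            (ENNReal.ofReal ((d * A₂) ^ k) * eLpNorm (iteratedFDeriv ℝ k ⇑u) p volume) := by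
          gcongr
      _ = ENNReal.ofReal (C⁻¹ ^ (k + 1) * (d * A₂) ^ k) *
            eLpNorm (iteratedFDeriv ℝ k ⇑u) p volume := by
          rw [ENNReal.ofReal_mul (by positivity), mul_assoc]
      _ ≤ eLpNorm (iteratedFDeriv ℝ k ⇑u) p volume :=
          mul_le_of_le_one_left' (ENNReal.ofReal_le_one.2 hone)
  · have hstep (j : Fin d) (v : 𝓢(EuclideanSpace ℝ (Fin d), ℂ))
        (hv : Function.support ⇑(𝓕 v : 𝓢(EuclideanSpace ℝ (Fin d), ℂ)) ⊆
          {ξ | r * lam ≤ ‖ξ‖ ∧ ‖ξ‖ ≤ R * lam}) :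
        eLpNorm ⇑(∂_{b j} v : 𝓢(EuclideanSpace ℝ (Fin d), ℂ)) p volume ≤
          ENNReal.ofReal (A * lam) * eLpNorm v p volume := by
      refine (hA₁ j p hp lam hlam v hv).trans ?_
      gcongr
      exact hle j
    calc eLpNorm (iteratedFDeriv ℝ k ⇑u) p volume
        ≤ ∑ _s : Fin k → Fin d, ENNReal.ofReal (A * lam) ^ k * eLpNorm u p volume :=
          (eLpNorm_iteratedFDeriv_le_sum b u k hp).trans <| Finset.sum_le_sum fun s _ ↦
            eLpNorm_iteratedLineDerivOp_le_of_forall b hstep u hu s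
      _ = ENNReal.ofReal ((d * A) ^ k * lam ^ k) * eLpNorm u p volume := by
          rw [Finset.sum_const, Finset.card_univ, nsmul_eq_mul, ← mul_assoc,
            ← ENNReal.ofReal_pow (by positivity), ← ENNReal.ofReal_natCast,
            ← ENNReal.ofReal_mul (by positivity)]
          congr 2
          simp
          ring
      _ ≤ ENNReal.ofReal (C ^ (k + 1) * lam ^ k) * eLpNorm (⇑u) p volume := by
          gcongr
          calc (d * A) ^ k ≤ C ^ k := by gcongr; linarith
            _ ≤ C ^ (k + 1) := pow_le_pow_right₀ hC1 (Nat.le_succ k)
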